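/- arXiv:1706.09164 — 2 statements merged into one kernel-verified Lean document; each statement's English description precedes it below -/
import Mathlib

section
/- A topological space X is Hausdorff if and only if for every injective continuous map j from the two-point discrete space into X, j has the left lifting property with respect to the unique map from D₃ to the one-point space, where D₃ is the three-point space on {a, z, b} whose open sets are the up-sets of the preorder generated by z ≤ a and z ≤ b (p ≤ q meaning p ∈ cl{q}). -/
/-- The Alexandrov topology on a preordered set: open sets are exactly the
upward-closed sets (here `p ≤ q` means `p ∈ closure {q}`). -/
def upTop (α : Type*) [Preorder α] : TopologicalSpace α where
  IsOpen s := ∀ ⦃a b : α⦄, a ∈ s → a ≤ b → b ∈ s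
  isOpen_univ := fun _ _ _ _ => trivial
  isOpen_inter := fun s t hs ht a b hab hle => ⟨hs hab.1 hle, ht hab.2 hle⟩
  isOpen_sUnion := fun S hS a b ha hle => by
    obtain ⟨s, hsS, has⟩ := ha
    exact ⟨s, hsS, hS s hsS has hle⟩

/-- The preorder generated by a relation `r`: its `≤` is the reflexive-transitive
closure of `r`. -/
def genPreorder {α : Type*} (r : α → α → Prop) : Preorder α where
  le := Relation.ReflTransGen r
  le_refl _ := Relation.ReflTransGen.refl
  le_trans _ _ _ h h' := Relation.ReflTransGen.trans h h'

/-- A continuous map `f : A → B` has the left lifting property with respect to a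
continuous map `g : Z → Y` if for all continuous `u : A → Z` and `v : B → Y`
with `g ∘ u = v ∘ f` there is a continuous `d : B → Z` with `d ∘ f = u` and
`g ∘ d = v`. -/
def HasLLP {A B Z Y : Type*} [TopologicalSpace A] [TopologicalSpace B]
    [TopologicalSpace Z] [TopologicalSpace Y] (f : A → B) (g : Z → Y) : Prop :=
  ∀ (u : A → Z) (v : B → Y), Continuous u → Continuous v → g ∘ u = v ∘ f →
    ∃ d : B → Z, Continuous d ∧ d ∘ f = u ∧ g ∘ d = v

/-- The two-point discrete space. -/
inductive TwoD | a | b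

instance : TopologicalSpace TwoD := ⊥

/-- The three-point space on `{a, z, b}`. -/
inductive D3 | a | z | b

/-- Generating relation for the preorder on `D3`: `z ≤ a` and `z ≤ b`
(`p ≤ q` meaning `p ∈ closure {q}`). -/
def rD3 : D3 → D3 → Prop := fun p q =>
  (p = D3.z ∧ q = D3.a) ∨ (p = D3.z ∧ q = D3.b)

instance : Preorder D3 := genPreorder rD3
instance : TopologicalSpace D3 := upTop D3

theorem D3.isOpen_iff {s : Set D3} : IsOpen s ↔ (D3.z ∈ s → s = Set.univ) := by
  constructor
  · intro h hz
    refine Set.eq_univ_of_forall fun x => h hz ?_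
    cases x with
    | a => exact Relation.ReflTransGen.single (Or.inl ⟨rfl, rfl⟩)
    | z => exact le_refl _
    | b => exact Relation.ReflTransGen.single (Or.inr ⟨rfl, rfl⟩)
  · intro h x y hx hxy
    obtain rfl | ⟨w, hw, -⟩ := Relation.ReflTransGen.cases_head hxy
    · exact hx
    · have hz : x = D3.z := by rcases hw with hw | hw <;> exact hw.1
      rw [h (hz ▸ hx)]
      trivial

theorem D3.continuous_iff {X : Type*} [TopologicalSpace X] {d : X → D3} :
    Continuous d ↔ IsOpen (d ⁻¹' {D3.a}) ∧ IsOpen (d ⁻¹' {D3.b}) := by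
  constructor
  · intro hd
    exact ⟨(D3.isOpen_iff.2 (by simp)).preimage hd, (D3.isOpen_iff.2 (by simp)).preimage hd⟩
  · rintro ⟨ha, hb⟩
    refine continuous_def.2 fun s hs => isOpen_iff_forall_mem_open.2 fun x hx => ?_
    have hsub : ∀ {c}, d x = c → d ⁻¹' {c} ⊆ d ⁻¹' s := by
      rintro c rfl y hy
      simp only [Set.mem_preimage, Set.mem_singleton_iff] at hy
      simpa only [Set.mem_preimage, hy] using hx
    cases h : d x with
    | a => exact ⟨_, hsub h, ha, h⟩
    | b => exact ⟨_, hsub h, hb, h⟩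
    | z =>
      have hz : D3.z ∈ s := h ▸ hx
      exact ⟨Set.univ, by simp [D3.isOpen_iff.1 hs hz], isOpen_univ, trivial⟩

open Classical in
/-- Disjoint open sets `U`, `V` and points `p`, `q` of `D3` give a continuous map to `D3` that is
constantly `p` on `U` and `q` on `V`. -/
theorem D3.exists_continuous_of_disjoint {X : Type*} [TopologicalSpace X] {U V : Set X}
    (hU : IsOpen U) (hV : IsOpen V) (hUV : Disjoint U V) (p q : D3) :
    ∃ d : X → D3, Continuous d ∧ (∀ x ∈ U, d x = p) ∧ ∀ x ∈ V, d x = q := by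
  have hdU : ∀ x ∈ V, x ∉ U := fun x hV hU => Set.disjoint_left.1 hUV hU hV
  let d : X → D3 := fun x => if x ∈ U then p else if x ∈ V then q else D3.z
  have hp : ∀ x ∈ U, d x = p := fun x hx => by simp [d, hx]
  have hq : ∀ x ∈ V, d x = q := fun x hx => by simp [d, hx, hdU x hx]
  have hopen : ∀ c, c ≠ D3.z → IsOpen (d ⁻¹' {c}) := by
    refine fun c hc => isOpen_iff_forall_mem_open.2 fun x hx => ?_
    simp only [Set.mem_preimage, Set.mem_singleton_iff] at hx
    by_cases hxU : x ∈ U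
    · exact ⟨U, fun y hy => (hp y hy).trans ((hp x hxU).symm.trans hx), hU, hxU⟩
    by_cases hxV : x ∈ V
    · exact ⟨V, fun y hy => (hq y hy).trans ((hq x hxV).symm.trans hx), hV, hxV⟩
    · exact absurd (by simpa [d, hxU, hxV] using hx.symm) hc
  exact ⟨d, D3.continuous_iff.2 ⟨hopen _ (by simp), hopen _ (by simp)⟩, hp, hq⟩

instance : DiscreteTopology TwoD := ⟨rfl⟩

/-- A topological space `X` is Hausdorff iff every injective continuous map `j`
from the two-point discrete space into `X` has the left lifting property with
respect to the unique map from `D₃` to the one-point space, where `D₃` is the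
three-point space whose open sets are the up-sets of the preorder generated by
`z ≤ a` and `z ≤ b`. -/
theorem statement10 {X : Type*} [TopologicalSpace X] :
    T2Space X ↔
      ∀ j : TwoD → X, Continuous j → Function.Injective j →
        HasLLP j (fun _ : D3 => PUnit.unit) := by
  constructor
  · intro _ j _ hj u v _ _ _
    obtain ⟨U, V, hU, hV, haU, hbV, hUV⟩ := t2_separation (hj.ne (by simp : TwoD.a ≠ TwoD.b))
    obtain ⟨d, hd, hdU, hdV⟩ :=
      D3.exists_continuous_of_disjoint hU hV hUV (u TwoD.a) (u TwoD.b)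
    refine ⟨d, hd, funext fun t => ?_, rfl⟩
    cases t with
    | a => exact hdU _ haU
    | b => exact hdV _ hbV
  · intro h
    refine ⟨fun x y hxy => ?_⟩
    let j : TwoD → X := fun t => TwoD.casesOn t x y
    have hj : Function.Injective j := by
      rintro (_ | _) (_ | _) hst
      exacts [rfl, absurd hst hxy, absurd hst.symm hxy, rfl]
    let u : TwoD → D3 := fun t => TwoD.casesOn t D3.a D3.b
    obtain ⟨d, hd, hdu, -⟩ := h j continuous_of_discreteTopology hj u (fun _ => PUnit.unit)
      continuous_of_discreteTopology continuous_const rfl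
    obtain ⟨ha, hb⟩ := D3.continuous_iff.1 hd
    exact ⟨_, _, ha, hb, congrFun hdu TwoD.a, congrFun hdu TwoD.b,
      Disjoint.preimage d (by simp)⟩
end

section
/- A topological space X is perfectly normal (any two disjoint closed subsets A, B are precisely separated by a continuous function: there is a continuous f : X → [0,1] with f⁻¹({0}) = A and f⁻¹({1}) = B) if and only if the map from the empty space to X has the left lifting property with respect to the map q : [0,1] → C₃, where C₃ is the three-point space on {p, m, r} whose open sets are the up-sets of the preorder generated by p ≤ m and r ≤ m (a ≤ b meaning a ∈ cl{b}), and q sends 0 to p, 1 to r, and every point of (0,1) to m. -/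
/-- The three-point space on `{p, m, r}`. -/
inductive C3 | p | m | r

/-- Generating relation for the preorder on `C3`: `p ≤ m` and `r ≤ m`
(`a ≤ b` meaning `a ∈ closure {b}`). -/
def rC3 : C3 → C3 → Prop := fun a b =>
  (a = C3.p ∧ b = C3.m) ∨ (a = C3.r ∧ b = C3.m)

instance : Preorder C3 := genPreorder rC3
instance : TopologicalSpace C3 := upTop C3

open Classical in
/-- The map `q : [0,1] → C₃` sending `0` to `p`, `1` to `r`, and every point of
`(0,1)` to `m`. -/
noncomputable def qIC : Set.Icc (0:ℝ) 1 → C3 := fun t =>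
  if (t : ℝ) = 0 then C3.p else if (t : ℝ) = 1 then C3.r else C3.m

theorem C3.le_iff {a b : C3} : a ≤ b ↔ a = b ∨ b = C3.m := by
  constructor
  · intro h
    induction h with
    | refl => exact Or.inl rfl
    | tail _ h _ => exact Or.inr (h.elim And.right And.right)
  · rintro (rfl | rfl)
    · exact le_refl _
    · cases a
      · exact Relation.ReflTransGen.single (Or.inl ⟨rfl, rfl⟩)
      · exact le_refl _
      · exact Relation.ReflTransGen.single (Or.inr ⟨rfl, rfl⟩)

theorem C3.isOpen_iff {s : Set C3} : IsOpen s ↔ (s.Nonempty → C3.m ∈ s) := by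
  constructor
  · rintro h ⟨a, ha⟩
    exact h ha (C3.le_iff.2 (Or.inr rfl))
  · rintro h a b ha hab
    rcases C3.le_iff.1 hab with rfl | rfl
    · exact ha
    · exact h ⟨a, ha⟩

theorem C3.isClosed_singleton_p : IsClosed ({C3.p} : Set C3) :=
  ⟨C3.isOpen_iff.2 fun _ => by simp⟩

theorem C3.isClosed_singleton_r : IsClosed ({C3.r} : Set C3) :=
  ⟨C3.isOpen_iff.2 fun _ => by simp⟩

/-- A map to `C3` is continuous as soon as the fibres over the two closed points are closed. -/
theorem C3.continuous_of_isClosed {X : Type*} [TopologicalSpace X] {v : X → C3}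
    (hp : IsClosed (v ⁻¹' {C3.p})) (hr : IsClosed (v ⁻¹' {C3.r})) : Continuous v := by
  refine ⟨fun s hs => ?_⟩
  rcases s.eq_empty_or_nonempty with rfl | hne
  · simp
  have hm := C3.isOpen_iff.1 hs hne
  have hclosed : IsClosed (v ⁻¹' sᶜ) := by
    have key : v ⁻¹' sᶜ = {x | C3.p ∉ s ∧ v x = C3.p} ∪ {x | C3.r ∉ s ∧ v x = C3.r} := by
      ext x
      cases hx : v x <;> simp [hx, hm]
    rw [key]
    exact (isClosed_const.and hp).union (isClosed_const.and hr)
  simpa using hclosed.isOpen_compl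

theorem qIC_eq_p_iff {t : Set.Icc (0:ℝ) 1} : qIC t = C3.p ↔ t = ⟨0, by norm_num⟩ := by
  rw [Subtype.ext_iff]
  unfold qIC
  split_ifs <;> simp_all

theorem qIC_eq_r_iff {t : Set.Icc (0:ℝ) 1} : qIC t = C3.r ↔ t = ⟨1, by norm_num⟩ := by
  rw [Subtype.ext_iff]
  unfold qIC
  split_ifs <;> simp_all

/-- A topological space `X` is perfectly normal (any two disjoint closed
subsets `A`, `B` are precisely separated by a continuous function: there is a
continuous `f : X → [0,1]` with `f ⁻¹' {0} = A` and `f ⁻¹' {1} = B`) iff the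
map from the empty space to `X` has the left lifting property with respect to
the map `q : [0,1] → C₃`. -/
theorem statement17 {X : Type*} [TopologicalSpace X] :
    (∀ A B : Set X, IsClosed A → IsClosed B → Disjoint A B →
      ∃ f : X → Set.Icc (0:ℝ) 1, Continuous f ∧
        f ⁻¹' {⟨0, by norm_num⟩} = A ∧ f ⁻¹' {⟨1, by norm_num⟩} = B) ↔
      HasLLP (Empty.elim : Empty → X) qIC := by
  constructor
  · intro h u v _ hv _
    obtain ⟨f, hf, hA, hB⟩ := h (v ⁻¹' {C3.p}) (v ⁻¹' {C3.r})
      (C3.isClosed_singleton_p.preimage hv) (C3.isClosed_singleton_r.preimage hv)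
      (Disjoint.preimage v (by simp))
    refine ⟨f, hf, funext fun e => e.elim, funext fun x => ?_⟩
    have hp : qIC (f x) = C3.p ↔ v x = C3.p := qIC_eq_p_iff.trans (Set.ext_iff.1 hA x)
    have hr : qIC (f x) = C3.r ↔ v x = C3.r := qIC_eq_r_iff.trans (Set.ext_iff.1 hB x)
    rw [Function.comp_apply]
    cases h₁ : qIC (f x) <;> cases h₂ : v x <;> simp_all
  · intro h A B hA hB hAB
    classical
    let v : X → C3 := fun x => if x ∈ A then C3.p else if x ∈ B then C3.r else C3.m
    have hvp : v ⁻¹' {C3.p} = A := by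
      ext x
      simp only [v, Set.mem_preimage, Set.mem_singleton_iff]
      split_ifs <;> simp_all
    have hvr : v ⁻¹' {C3.r} = B := by
      ext x
      have := fun hx : x ∈ A => Set.disjoint_left.1 hAB hx
      simp only [v, Set.mem_preimage, Set.mem_singleton_iff]
      split_ifs <;> simp_all
    obtain ⟨d, hd, -, hqd⟩ := h Empty.elim v
      ⟨fun s _ => by rw [Set.eq_empty_of_isEmpty (Empty.elim ⁻¹' s)]; exact isOpen_empty⟩
      (C3.continuous_of_isClosed (hvp ▸ hA) (hvr ▸ hB)) (funext fun e => e.elim)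
    refine ⟨d, hd, ?_, ?_⟩
    · rw [← hvp, ← hqd]
      exact Set.ext fun x => qIC_eq_p_iff.symm
    · rw [← hvr, ← hqd]
      exact Set.ext fun x => qIC_eq_r_iff.symm
end
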